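/- For nonnegative integers n and p: P(2n, n, p+1) = P(n+p, p), where P(a,b) denotes the number of partitions of a into exactly b parts and P(a,b,c) the number of partitions of a into exactly b parts each at most c. -/

import Mathlib

/-- \`Pm n m\` is the number of integer partitions of \`n\` into exactly \`m\` parts. -/
def Pm (n m : ℕ) : ℕ :=
  Fintype.card {π : Nat.Partition n // π.parts.card = m}

/-- \`PexactN n m p\` is the number of integer partitions of \`n\` into exactly \`m\` parts,
each part at most \`p\`. -/
def PexactN (n m p : ℕ) : ℕ :=
  Fintype.card {π : Nat.Partition n // π.parts.card = m ∧ ∀ x ∈ π.parts, x ≤ p}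

namespace Nat.Partition

/-- Partitions of `n + m` into exactly `m` parts, each at most `q + 1`, correspond to partitions
of `n` into at most `m` parts, each at most `q`, by lowering every part by one. -/
def lowerPartsEquiv (n m q : ℕ) :
    {π : Nat.Partition (n + m) // π.parts.card = m ∧ ∀ x ∈ π.parts, x ≤ q + 1} ≃
      {π : Nat.Partition n // π.parts.card ≤ m ∧ ∀ x ∈ π.parts, x ≤ q} where
  toFun π := ⟨ofSums n (π.1.parts.map Nat.pred) (by
      have hsum : ((π.1.parts.map Nat.pred).map Nat.succ).sum = n + m := by
        rw [Multiset.map_map, Multiset.map_congr rfl (g := id), Multiset.map_id, π.1.parts_sum]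
        intro x hx
        exact Nat.succ_pred (π.1.parts_pos hx).ne'
      have hcard := π.2.1
      simp only [Nat.succ_eq_add_one, Multiset.sum_map_add, Multiset.map_id', Multiset.map_const',
        Multiset.sum_replicate, Multiset.card_map, smul_eq_mul, mul_one] at hsum
      omega), by
    constructor
    · rw [ofSums_parts]
      exact (Multiset.card_le_card (Multiset.filter_le _ _)).trans (by simp [π.2.1])
    · intro x hx
      obtain ⟨y, hy, rfl⟩ := Multiset.mem_map.1 (Multiset.mem_of_mem_filter hx)
      exact Nat.pred_le_pred (π.2.2 y hy)⟩
  invFun π := ⟨⟨(π.1.parts + Multiset.replicate (m - π.1.parts.card) 0).map Nat.succ, by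
      intro i hi
      obtain ⟨y, -, rfl⟩ := Multiset.mem_map.1 hi
      exact y.succ_pos, by
      have hcard := π.2.1
      simp only [Nat.succ_eq_add_one, Multiset.sum_map_add, Multiset.map_id', Multiset.map_const',
        Multiset.sum_replicate, Multiset.sum_add, Multiset.card_add, Multiset.card_replicate,
        smul_eq_mul, mul_one, mul_zero, π.1.parts_sum]
      omega⟩, by
    constructor
    · have hcard := π.2.1
      simp only [Multiset.card_map, Multiset.card_add, Multiset.card_replicate]
      omega
    · intro x hx
      obtain ⟨y, hy, rfl⟩ := Multiset.mem_map.1 hx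
      apply Nat.succ_le_succ
      rcases Multiset.mem_add.1 hy with hy | hy
      · exact π.2.2 y hy
      · simp [Multiset.eq_of_mem_replicate hy]⟩
  left_inv π := by
    apply Subtype.ext
    apply Nat.Partition.ext
    simp only [ofSums_parts]
    have hsplit := Multiset.filter_add_not (· ≠ 0) (π.1.parts.map Nat.pred)
    have hzero : (π.1.parts.map Nat.pred).filter (fun x => ¬ x ≠ 0) = Multiset.replicate
        (m - ((π.1.parts.map Nat.pred).filter (· ≠ 0)).card) 0 := by
      apply Multiset.eq_replicate.2
      refine ⟨?_, fun x hx => not_not.1 (Multiset.mem_filter.1 hx).2⟩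
      have hcard := congrArg Multiset.card hsplit
      rw [Multiset.card_add, Multiset.card_map, π.2.1] at hcard
      omega
    rw [← hzero, hsplit, Multiset.map_map, Multiset.map_congr rfl (g := id), Multiset.map_id]
    intro x hx
    exact Nat.succ_pred (π.1.parts_pos hx).ne'
  right_inv π := by
    apply Subtype.ext
    apply Nat.Partition.ext
    simp only [ofSums_parts, Multiset.map_map, Function.comp_def, Nat.pred_succ, Multiset.map_id',
      Multiset.filter_add]
    rw [Multiset.filter_eq_self.2 fun x hx => (π.1.parts_pos hx).ne',
      Multiset.filter_eq_nil.2 fun x hx => by simp [Multiset.eq_of_mem_replicate hx], add_zero]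

end Nat.Partition

namespace YoungDiagram

theorem sum_rowLens (μ : YoungDiagram) : μ.rowLens.sum = μ.card := by
  have hmaps : ∀ c ∈ μ.cells, c.1 ∈ Finset.range (μ.colLen 0) := by
    intro c hc
    rw [Finset.mem_range, ← mem_iff_lt_colLen]
    exact μ.up_left_mem le_rfl (Nat.zero_le c.2) hc
  rw [YoungDiagram.card, Finset.card_eq_sum_card_fiberwise hmaps]
  change ∑ i ∈ Finset.range (μ.colLen 0), μ.rowLen i = _
  exact Finset.sum_congr rfl fun i _ => μ.rowLen_eq_card

theorem card_transpose (μ : YoungDiagram) : μ.transpose.card = μ.card := by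
  apply Finset.card_bij (fun c _ => c.swap)
  · intro c hc
    exact mem_transpose.1 hc
  · intro a _ b _ h
    exact Prod.swap_injective h
  · intro c hc
    exact ⟨c.swap, mem_transpose.2 (by simpa using hc), c.swap_swap⟩

theorem forall_mem_rowLens_le_iff (μ : YoungDiagram) (p : ℕ) :
    (∀ x ∈ μ.rowLens, x ≤ p) ↔ μ.rowLen 0 ≤ p := by
  constructor
  · intro h
    by_contra! hlt
    have hmem : (0, 0) ∈ μ := mem_iff_lt_rowLen.2 (by omega)
    exact hlt.not_ge (h _ (List.mem_map.2 ⟨0, List.mem_range.2 (mem_iff_lt_colLen.1 hmem), rfl⟩))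
  · intro h x hx
    obtain ⟨i, -, rfl⟩ := List.mem_map.1 hx
    exact (μ.rowLen_anti 0 i (Nat.zero_le i)).trans h

/-- Young diagrams with `n` cells correspond to partitions of `n` via their row lengths. -/
def equivPartition (n : ℕ) : {μ : YoungDiagram // μ.card = n} ≃ Nat.Partition n where
  toFun μ := ⟨μ.1.rowLens, fun {i} hi => μ.1.pos_of_mem_rowLens i hi, by
    rw [Multiset.sum_coe, sum_rowLens, μ.2]⟩
  invFun π := ⟨ofRowLens (π.parts.sort (· ≥ ·)) (Multiset.pairwise_sort _ _).sortedGE, by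
    rw [← sum_rowLens, rowLens_ofRowLens_eq_self, ← Multiset.sum_coe, Multiset.sort_eq,
      π.parts_sum]
    intro x hx
    exact π.parts_pos ((Multiset.mem_sort _).1 hx)⟩
  left_inv μ := by
    apply Subtype.ext
    have hsort : (μ.1.rowLens : Multiset ℕ).sort (· ≥ ·) = μ.1.rowLens := by
      rw [Multiset.coe_sort]
      exact List.mergeSort_eq_self _ μ.1.rowLens_sorted.pairwise
    simp only [hsort]
    exact ofRowLens_to_rowLens_eq_self
  right_inv π := by
    apply Nat.Partition.ext
    simp only
    rw [rowLens_ofRowLens_eq_self, Multiset.sort_eq]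
    intro x hx
    exact π.parts_pos ((Multiset.mem_sort _).1 hx)

theorem card_equivPartition_parts {n : ℕ} (μ : {μ : YoungDiagram // μ.card = n}) :
    (equivPartition n μ).parts.card = μ.1.colLen 0 :=
  length_rowLens

theorem forall_mem_equivPartition_parts_le_iff {n : ℕ} (μ : {μ : YoungDiagram // μ.card = n})
    (p : ℕ) : (∀ x ∈ (equivPartition n μ).parts, x ≤ p) ↔ μ.1.rowLen 0 ≤ p :=
  μ.1.forall_mem_rowLens_le_iff p

end YoungDiagram

namespace Nat.Partition

/-- The conjugate of a partition, obtained by transposing its Young diagram. -/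
def conjugateEquiv (n : ℕ) : Nat.Partition n ≃ Nat.Partition n :=
  (YoungDiagram.equivPartition n).symm.trans <|
    (YoungDiagram.transposeOrderIso.toEquiv.subtypeEquiv fun μ => by
      change μ.card = n ↔ μ.transpose.card = n
      rw [μ.card_transpose]).trans (YoungDiagram.equivPartition n)

theorem card_conjugateEquiv_parts_le_iff {n : ℕ} (π : Nat.Partition n) (p : ℕ) :
    (conjugateEquiv n π).parts.card ≤ p ↔ ∀ x ∈ π.parts, x ≤ p := by
  obtain ⟨μ, rfl⟩ := (YoungDiagram.equivPartition n).surjective π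
  rw [YoungDiagram.forall_mem_equivPartition_parts_le_iff, conjugateEquiv, Equiv.trans_apply,
    Equiv.symm_apply_apply, Equiv.trans_apply, YoungDiagram.card_equivPartition_parts]
  exact (congrArg (· ≤ p) (μ.1.colLen_transpose 0)).to_iff

theorem card_parts_le {n : ℕ} (π : Nat.Partition n) : π.parts.card ≤ n := by
  simpa [π.parts_sum] using Multiset.card_nsmul_le_sum (a := 1) fun x hx => π.parts_pos hx

end Nat.Partition

theorem PexactN_add (n m q : ℕ) : PexactN (n + m) m (q + 1) =
    Fintype.card {π : Nat.Partition n // π.parts.card ≤ m ∧ ∀ x ∈ π.parts, x ≤ q} :=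
  Fintype.card_congr (Nat.Partition.lowerPartsEquiv n m q)

theorem Pm_eq_PexactN {n q : ℕ} (h : n ≤ q) (m : ℕ) : Pm n m = PexactN n m q :=
  Fintype.card_congr <| Equiv.subtypeEquivRight fun π =>
    (and_iff_left fun _ hx => (π.le_of_mem_parts hx).trans h).symm

theorem Pexact_two_n (n p : ℕ) : PexactN (2 * n) n (p + 1) = Pm (n + p) p := by
  rw [Pm_eq_PexactN (Nat.le_succ (n + p)), two_mul, PexactN_add, PexactN_add]
  refine Fintype.card_congr ((Nat.Partition.conjugateEquiv n).subtypeEquiv fun π => ?_)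
  rw [Nat.Partition.card_conjugateEquiv_parts_le_iff, and_iff_right π.card_parts_le,
    and_iff_left fun x hx => (Nat.Partition.le_of_mem_parts hx).trans (Nat.le_add_right n p)]
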